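/- Let R be a commutative ring, t an element of R, and A an associative R-algebra. Suppose x : ℤ → A is a family of elements satisfying, for all m, n ∈ ℤ, the quadratic relation x(m+1)x(n) + x(n+1)x(m) = t·(x(m)x(n+1) + x(n)x(m+1)). Then for all m₁, m₂, m₃ ∈ ℤ, the sum over all permutations σ of {1,2,3} of [ − x(m_{σ(1)}+1)·x(m_{σ(2)}+1)·x(m_{σ(3)}) − t³·x(m_{σ(1)})·x(m_{σ(2)}+1)·x(m_{σ(3)}+1) + (t + t²)·x(m_{σ(1)}+1)·x(m_{σ(2)})·x(m_{σ(3)}+1) ] equals 0. -/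

import Mathlib

open scoped BigOperators

theorem sum_perm_fin_three {M : Type*} [AddCommMonoid M] {α : Type*} (v : Fin 3 → α)
    (f : α → α → α → M) :
    ∑ σ : Equiv.Perm (Fin 3), f (v (σ 0)) (v (σ 1)) (v (σ 2)) =
      (f (v 0) (v 1) (v 2) + f (v 0) (v 2) (v 1)) + (f (v 1) (v 0) (v 2) + f (v 1) (v 2) (v 0)) +
        (f (v 2) (v 0) (v 1) + f (v 2) (v 1) (v 0)) := by
  have h : (Finset.univ : Finset (Equiv.Perm (Fin 3))) =
      {1, Equiv.swap 1 2, Equiv.swap 0 1, Equiv.swap 0 1 * Equiv.swap 1 2,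
        Equiv.swap 0 2 * Equiv.swap 1 2, Equiv.swap 0 2} := by decide
  rw [h]
  repeat rw [Finset.sum_insert (by decide)]
  rw [Finset.sum_singleton]
  simp only [add_assoc]
  rfl

/-- coefficientwise symmetrization identity
`Sym_{z₁,z₂,z₃}{(−z₁z₂ − t³z₂z₃ + (t+t²)z₁z₃)·X(z₁)X(z₂)X(z₃)} = 0`
for a current satisfying the quantum affine sl₂ quadratic relation. -/
theorem symmetrization_identity_quadratic
    {R : Type*} {A : Type*} [CommRing R] [Ring A] [Algebra R A]
    (t : R) (x : ℤ → A)
    (hx : ∀ m n : ℤ,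
      x (m + 1) * x n + x (n + 1) * x m
        = t • (x m * x (n + 1) + x n * x (m + 1))) :
    ∀ m₁ m₂ m₃ : ℤ,
      (∑ σ : Equiv.Perm (Fin 3),
        (-(x (![m₁, m₂, m₃] (σ 0) + 1) * x (![m₁, m₂, m₃] (σ 1) + 1) * x (![m₁, m₂, m₃] (σ 2)))
          - t ^ 3 • (x (![m₁, m₂, m₃] (σ 0)) * x (![m₁, m₂, m₃] (σ 1) + 1)
              * x (![m₁, m₂, m₃] (σ 2) + 1))
          + (t + t ^ 2) • (x (![m₁, m₂, m₃] (σ 0) + 1) * x (![m₁, m₂, m₃] (σ 1))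
              * x (![m₁, m₂, m₃] (σ 2) + 1)))) = 0 := by
  intro a b c
  have left (a b c : ℤ) : x (c + 1) * x (a + 1) * x b + x (c + 1) * x (b + 1) * x a
      = t • (x (c + 1) * x a * x (b + 1) + x (c + 1) * x b * x (a + 1)) := by
    simpa only [mul_add, mul_smul_comm, mul_assoc] using congrArg (x (c + 1) * ·) (hx a b)
  have right (a b c : ℤ) : x (a + 1) * x b * x (c + 1) + x (b + 1) * x a * x (c + 1)
      = t • (x a * x (b + 1) * x (c + 1) + x b * x (a + 1) * x (c + 1)) := by
    simpa only [add_mul, smul_mul_assoc] using congrArg (· * x (c + 1)) (hx a b)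
  rw [sum_perm_fin_three ![a, b, c] fun i j k =>
    -(x (i + 1) * x (j + 1) * x k) - t ^ 3 • (x i * x (j + 1) * x (k + 1))
      + (t + t ^ 2) • (x (i + 1) * x j * x (k + 1))]
  simp only [Matrix.cons_val]
  linear_combination (norm := module) (-1 : R) • (left a b c + left b c a + left a c b)
    + t ^ 2 • (right a b c + right b c a + right a c b)
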